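/- arXiv:1808.04697 — 2 statements merged into one kernel-verified Lean document; each statement's English description precedes it below -/
import Mathlib

section
/- Assume the arrangement A is locally free but not free, and D(A) has a minimal free resolution 0 → S[−d−1] →^F ⊕_{i=1}^{ℓ+1} S[−d_i] →^G D(A) → 0, where F = (f_1,…,f_ℓ,f_{ℓ+1}) and G = (θ_E, θ_2,…,θ_ℓ, θ_{ℓ+1}) with θ_E the Euler derivation. Then f_i ≠ 0 for all i = 2,…,ℓ+1. -/
open MvPolynomial

noncomputable section

attribute [local instance] Classical.propDecidable

namespace ArrPOG

variable (K : Type) [Field K] (ℓ : ℕ)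

/-- A polynomial vector field on `K^ℓ`: `θ = Σ θᵢ ∂/∂xᵢ`, identified with its
coefficient vector `(θ₁,…,θ_ℓ)` in `S = K[x₁,…,x_ℓ]`. -/
abbrev Deriv : Type := Fin ℓ → MvPolynomial (Fin ℓ) K

variable {K ℓ}

/-- The linear polynomial `α_H ∈ S` associated to a linear form `φ ∈ V*`. -/
def linPoly (φ : Module.Dual K (Fin ℓ → K)) : MvPolynomial (Fin ℓ) K :=
  ∑ i, MvPolynomial.C (φ (Pi.single i 1)) * MvPolynomial.X i

/-- `θ(α)` for a derivation `θ` and the linear form `α` given by `φ ∈ V*`. -/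
def applyLin (θ : Deriv K ℓ) (φ : Module.Dual K (Fin ℓ → K)) : MvPolynomial (Fin ℓ) K :=
  ∑ i, MvPolynomial.C (φ (Pi.single i 1)) * θ i

/-- An arrangement: a finite set of hyperplanes (kernels of nonzero linear forms). -/
def IsArrangement (A : Finset (Submodule K (Fin ℓ → K))) : Prop :=
  ∀ H ∈ A, ∃ φ : Module.Dual K (Fin ℓ → K), φ ≠ 0 ∧ LinearMap.ker φ = H

/-- Essential: the common intersection of all members is `0`. -/
def Essential (A : Finset (Submodule K (Fin ℓ → K))) : Prop :=
  A.inf id = ⊥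

/-- Membership in the logarithmic derivation module `D(A)`:
`θ(α_H) ∈ S·α_H` for every `H ∈ A`. -/
def InD (A : Finset (Submodule K (Fin ℓ → K))) (θ : Deriv K ℓ) : Prop :=
  ∀ H ∈ A, ∀ φ : Module.Dual K (Fin ℓ → K), LinearMap.ker φ = H → linPoly φ ∣ applyLin θ φ

/-- A derivation is homogeneous of degree `n` if all its coefficients are. -/
def HomogDeriv (θ : Deriv K ℓ) (n : ℕ) : Prop := ∀ i, (θ i).IsHomogeneous n

/-- `θ₁,…,θₙ` generate `D(A)` as an `S`-module. -/
def GeneratesD {n : ℕ} (A : Finset (Submodule K (Fin ℓ → K))) (θ : Fin n → Deriv K ℓ) : Prop :=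
  (∀ i, InD A (θ i)) ∧
    ∀ η, InD A η → ∃ c : Fin n → MvPolynomial (Fin ℓ) K, η = ∑ i, c i • θ i

/-- `S`-linear independence of a family of derivations. -/
def IndepD {n : ℕ} (θ : Fin n → Deriv K ℓ) : Prop :=
  ∀ c : Fin n → MvPolynomial (Fin ℓ) K, (∑ i, c i • θ i) = 0 → ∀ i, c i = 0

/-- `A` is free with exponents `e`: `D(A)` has a homogeneous basis of degrees `e i`. -/
def IsFreeExp (A : Finset (Submodule K (Fin ℓ → K))) (e : Fin ℓ → ℕ) : Prop :=
  ∃ θ : Fin ℓ → Deriv K ℓ, (∀ i, HomogDeriv (θ i) (e i)) ∧ GeneratesD A θ ∧ IndepD θ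

/-- `A` is free. -/
def IsFree (A : Finset (Submodule K (Fin ℓ → K))) : Prop := ∃ e, IsFreeExp A e

/-- `A` is plus-one generated with exponents `e`, level `lev`, realized by the minimal
homogeneous generators `θ₁,…,θ_ℓ, φ` whose unique syzygy is `Σ fᵢ•θᵢ + α•φ = 0`:
this encodes the minimal free resolution
`0 → S[-lev-1] → S[-lev] ⊕ (⊕ S[-eᵢ]) → D(A) → 0`. -/
def IsPOGWith (A : Finset (Submodule K (Fin ℓ → K))) (e : Fin ℓ → ℕ) (lev : ℕ)
    (θ : Fin ℓ → Deriv K ℓ) (φ : Deriv K ℓ)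
    (f : Fin ℓ → MvPolynomial (Fin ℓ) K) (α : MvPolynomial (Fin ℓ) K) : Prop :=
  (∀ i, InD A (θ i)) ∧ InD A φ ∧
  (∀ i, HomogDeriv (θ i) (e i)) ∧ HomogDeriv φ lev ∧
  (∀ η, InD A η → ∃ (c : Fin ℓ → MvPolynomial (Fin ℓ) K) (g : MvPolynomial (Fin ℓ) K),
      η = (∑ i, c i • θ i) + g • φ) ∧
  α.IsHomogeneous 1 ∧
  (∀ i, (f i).IsHomogeneous (lev + 1 - e i)) ∧
  (∀ i, MvPolynomial.constantCoeff (f i) = 0) ∧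
  ((∑ i, f i • θ i) + α • φ = 0) ∧
  (¬ (α = 0 ∧ ∀ i, f i = 0)) ∧
  (∀ (g : Fin ℓ → MvPolynomial (Fin ℓ) K) (h : MvPolynomial (Fin ℓ) K),
      ((∑ i, g i • θ i) + h • φ = 0) →
      ∃ q : MvPolynomial (Fin ℓ) K, (∀ i, g i = q * f i) ∧ h = q * α)

/-- Plus-one generated with exponents `e` and level `lev`. -/
def IsPOG (A : Finset (Submodule K (Fin ℓ → K))) (e : Fin ℓ → ℕ) (lev : ℕ) : Prop :=
  ∃ θ φ f α, IsPOGWith A e lev θ φ f α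

/-- Strictly plus-one generated: the level coefficient `α` is nonzero. -/
def IsSPOG (A : Finset (Submodule K (Fin ℓ → K))) (e : Fin ℓ → ℕ) (lev : ℕ) : Prop :=
  ∃ θ φ f α, IsPOGWith A e lev θ φ f α ∧ α ≠ 0

/-- The restriction `A^H = {L ⊓ H | L ∈ A \ {H}}`. -/
def restrict (A : Finset (Submodule K (Fin ℓ → K))) (H : Submodule K (Fin ℓ → K)) :
    Finset (Submodule K (Fin ℓ → K)) :=
  (A.erase H).image (fun L => L ⊓ H)

/-- The localization `A_X = {L ∈ A | X ⊆ L}`. -/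
def localize (A : Finset (Submodule K (Fin ℓ → K))) (X : Submodule K (Fin ℓ → K)) :
    Finset (Submodule K (Fin ℓ → K)) :=
  A.filter (fun L => X ≤ L)

/-- The intersection lattice of `A`, inside the ambient space `T`. -/
def latticeOf (T : Submodule K (Fin ℓ → K)) (A : Finset (Submodule K (Fin ℓ → K))) :
    Finset (Submodule K (Fin ℓ → K)) :=
  A.powerset.image (fun B => T ⊓ B.inf id)

/-- The Möbius function of the poset `L` (intersection lattice with top `T`). -/
def mob (T : Submodule K (Fin ℓ → K)) (L : Finset (Submodule K (Fin ℓ → K)))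
    (X : Submodule K (Fin ℓ → K)) : ℤ :=
  if X = T then 1
  else - ∑ Y ∈ (L.filter fun Z => X < Z).attach, mob T L Y.1
termination_by (L.filter fun Z => X < Z).card
decreasing_by
  obtain ⟨Y, hY⟩ := Y
  simp only [Finset.mem_filter] at hY
  apply Finset.card_lt_card
  rw [Finset.ssubset_def]
  constructor
  · intro Z hZ
    simp only [Finset.mem_filter] at hZ ⊢
    exact ⟨hZ.1, lt_trans hY.2 hZ.2⟩
  · intro hsub
    have h2 := hsub (Finset.mem_filter.mpr ⟨hY.1, hY.2⟩)
    simp only [Finset.mem_filter] at h2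
    exact lt_irrefl Y h2.2

/-- The characteristic polynomial `χ(A;t) = Σ_{X ∈ L(A)} μ(X) t^{dim X}`
of an arrangement inside the ambient space `T`. -/
def charPoly (T : Submodule K (Fin ℓ → K)) (A : Finset (Submodule K (Fin ℓ → K))) :
    Polynomial ℤ :=
  ∑ X ∈ latticeOf T A,
    Polynomial.C (mob T (latticeOf T A) X) * Polynomial.X ^ (Module.finrank K X)

/-- The Betti number `b_i(A)`: `χ(A;t) = Σ (-1)^i b_i(A) t^{ℓ-i}`. -/
def bNum (A : Finset (Submodule K (Fin ℓ → K))) (i : ℕ) : ℤ :=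
  (-1) ^ i * (charPoly (⊤ : Submodule K (Fin ℓ → K)) A).coeff (ℓ - i)

/-- Evaluation of the Poincaré polynomial `π(A;t) = Σ μ(X) (-t)^{codim X}` at `t : ℚ`. -/
def poincareEval (A : Finset (Submodule K (Fin ℓ → K))) (t : ℚ) : ℚ :=
  ∑ X ∈ latticeOf ⊤ A,
    (mob (⊤ : Submodule K (Fin ℓ → K)) (latticeOf ⊤ A) X : ℚ) *
      (-t) ^ (ℓ - Module.finrank K X)

/-- The Euler derivation `θ_E = Σ xᵢ ∂/∂xᵢ`. -/
def eulerD : Deriv K ℓ := fun i => MvPolynomial.X i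

/-- `A` is locally free: `A_X` is free for every `X ∈ L(A)` other than `∩_{H∈A} H`. -/
def LocallyFree (A : Finset (Submodule K (Fin ℓ → K))) : Prop :=
  ∀ X ∈ latticeOf ⊤ A, X ≠ A.inf id → IsFree (localize A X)

/-- Transport a finite set of subspaces contained in `T` to `K^m` along a linear
isomorphism `T ≃ K^m`. -/
def transport {m : ℕ} (T : Submodule K (Fin ℓ → K)) (eqv : T ≃ₗ[K] (Fin m → K))
    (A : Finset (Submodule K (Fin ℓ → K))) : Finset (Submodule K (Fin m → K)) :=
  A.image fun L => (L.comap T.subtype).map eqv.toLinearMap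

/-- An arrangement inside the subspace `T` is free with exponents `e`, i.e. it is free
after identifying `T` with a coordinate space. -/
def RestrFreeExp {m : ℕ} (T : Submodule K (Fin ℓ → K))
    (A : Finset (Submodule K (Fin ℓ → K))) (e : Fin m → ℕ) : Prop :=
  ∃ eqv : T ≃ₗ[K] (Fin m → K), IsFreeExp (transport T eqv A) e

/-- The multiset of exponents. -/
def expMS {n : ℕ} (e : Fin n → ℕ) : Multiset ℕ := Finset.univ.val.map e

/-- `D(A)` has projective dimension at most 1: some finite generating set has a free
(possibly zero) syzygy module, i.e. there is a free resolution
`0 → S^m → S^n → D(A) → 0`. -/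
def PdimLEOne (A : Finset (Submodule K (Fin ℓ → K))) : Prop :=
  ∃ (n m : ℕ) (θ : Fin n → Deriv K ℓ) (r : Fin m → Fin n → MvPolynomial (Fin ℓ) K),
    GeneratesD A θ ∧
    (∀ j, (∑ i, r j i • θ i) = 0) ∧
    (∀ c : Fin n → MvPolynomial (Fin ℓ) K, (∑ i, c i • θ i) = 0 →
      ∃ q : Fin m → MvPolynomial (Fin ℓ) K, ∀ i, c i = ∑ j, q j * r j i) ∧
    (∀ q : Fin m → MvPolynomial (Fin ℓ) K, (∀ i, (∑ j, q j * r j i) = 0) → ∀ j, q j = 0)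

/-- `A` has a free filtration `∅ = A₀ ⊂ A₁ ⊂ ⋯ ⊂ A_n = A`, `|A_i| = i`, each `A_i` free. -/
def HasFreeFiltration (A : Finset (Submodule K (Fin ℓ → K))) : Prop :=
  ∃ c : ℕ → Finset (Submodule K (Fin ℓ → K)),
    c A.card = A ∧ (∀ i ≤ A.card, (c i).card = i ∧ IsFree (c i)) ∧
    ∀ i < A.card, c i ⊆ c (i + 1)

/-- The intersection lattices of `A` and `B` are isomorphic: there is a bijection of
hyperplanes preserving the rank of every subset (equivalently, a lattice isomorphism). -/
def LatticeEquiv (A B : Finset (Submodule K (Fin ℓ → K))) : Prop :=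
  ∃ σ : Submodule K (Fin ℓ → K) → Submodule K (Fin ℓ → K),
    Set.BijOn σ ↑A ↑B ∧
    ∀ T ⊆ A, Module.finrank K ((T.inf id : Submodule K (Fin ℓ → K))) =
      Module.finrank K (((T.image σ).inf id : Submodule K (Fin ℓ → K)))


/-- Every maximal ideal of a polynomial ring in `n` variables has height at least `n`. -/
theorem height_maximal_ge {K : Type} [Field K] (n : ℕ) :
    ∀ M : Ideal (MvPolynomial (Fin n) K), M.IsMaximal → (n : ℕ∞) ≤ M.height := by
  induction n with
  | zero => intro M _; simp
  | succ n ih =>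
    intro M hM
    let E := (MvPolynomial.finSuccEquiv K n).toRingEquiv
    let P := M.map E
    have hP : P.IsMaximal := Ideal.map_isMaximal_of_equiv E
    have hh : P.height = M.height := RingEquiv.height_map E M
    have hp : (P.comap Polynomial.C).IsMaximal :=
      Polynomial.isMaximal_comap_C_of_isJacobsonRing P
    have : P.LiesOver (P.comap Polynomial.C) := ⟨rfl⟩
    rw [← hh, Polynomial.height_eq_height_add_one (P.comap Polynomial.C) P]
    push_cast
    gcongr
    exact ih _ hp

/-- `linPoly` as a linear map. -/
theorem linPoly_mem_of_span {K : Type} [Field K] {ℓ : ℕ}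
    (p : Ideal (MvPolynomial (Fin ℓ) K)) (B : Finset (Submodule K (Fin ℓ → K)))
    (φ : Submodule K (Fin ℓ → K) → Module.Dual K (Fin ℓ → K))
    (hk : ∀ H ∈ B, LinearMap.ker (φ H) = H) (hp : ∀ H ∈ B, linPoly (φ H) ∈ p)
    (ψ : Module.Dual K (Fin ℓ → K)) (hψ : B.inf id ≤ LinearMap.ker ψ) : linPoly ψ ∈ p := by
  have h1 : ψ ∈ Submodule.span K (Set.range fun H : B => φ H.1) := by
    apply mem_span_of_iInf_ker_le_ker
    refine le_trans ?_ hψ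
    apply Finset.le_inf
    intro H hH
    refine (iInf_le _ (⟨H, hH⟩ : B)).trans ?_
    rw [hk H hH]; rfl
  clear hψ
  induction h1 using Submodule.span_induction with
  | mem x hx => obtain ⟨H, rfl⟩ := hx; exact hp _ H.2
  | zero => simp [linPoly]
  | add x y _ _ hx hy =>
    have : linPoly (x + y) = linPoly x + linPoly y := by
      simp [linPoly, add_mul, Finset.sum_add_distrib]
    rw [this]
    exact p.add_mem hx hy
  | smul a x _ hx =>
    have : linPoly (a • x) = MvPolynomial.C a * linPoly x := by
      simp [linPoly, mul_assoc, Finset.mul_sum]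
    rw [this]
    exact p.mul_mem_left _ hx

theorem linPoly_dvd {K : Type} [Field K] {ℓ : ℕ}
    (φ ψ : Module.Dual K (Fin ℓ → K)) (h : LinearMap.ker φ = LinearMap.ker ψ) :
    linPoly φ ∣ linPoly ψ := by
  have := linPoly_mem_of_span (Ideal.span {linPoly φ}) {LinearMap.ker φ} (fun _ => φ)
    (by simp) (by intro _ _; exact Ideal.mem_span_singleton_self _) ψ (by simp [h])
  exact Ideal.mem_span_singleton.1 this

theorem applyLin_smul {K : Type} [Field K] {ℓ : ℕ} (q : MvPolynomial (Fin ℓ) K)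
    (θ : Deriv K ℓ) (φ : Module.Dual K (Fin ℓ → K)) :
    applyLin (q • θ) φ = q * applyLin θ φ := by
  simp only [applyLin, Finset.mul_sum, Pi.smul_apply, smul_eq_mul]
  exact Finset.sum_congr rfl fun i _ => by ring

theorem applyLin_sum {K : Type} [Field K] {ℓ n : ℕ}
    (θ : Fin n → Deriv K ℓ) (φ : Module.Dual K (Fin ℓ → K)) :
    applyLin (∑ i, θ i) φ = ∑ i, applyLin (θ i) φ := by
  simp only [applyLin, Finset.sum_apply, Finset.mul_sum]
  exact Finset.sum_comm

theorem linPoly_ne_zero {K : Type} [Field K] {ℓ : ℕ}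
    (φ : Module.Dual K (Fin ℓ → K)) (h : φ ≠ 0) : linPoly φ ≠ 0 := by
  intro h0
  apply h
  apply LinearMap.pi_ext'
  intro i
  ext
  have := congrArg (MvPolynomial.coeff (Finsupp.single i 1)) h0
  simpa [linPoly, MvPolynomial.coeff_sum, MvPolynomial.coeff_C_mul, MvPolynomial.coeff_X,
    Finsupp.single_left_inj] using this

/-- A matrix factoring `Q • 1` through a smaller free module forces `Q = 0`. -/
theorem factor_zero {R : Type*} [CommRing R] [IsDomain R] {n : ℕ} (Q : R)
    (B : Matrix (Fin (n + 1)) (Fin n) R) (C : Matrix (Fin n) (Fin (n + 1)) R)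
    (h : B * C = Q • (1 : Matrix (Fin (n + 1)) (Fin (n + 1)) R)) : Q = 0 := by
  by_contra hQ
  have hinj : Function.Injective C.mulVecLin := by
    rw [← LinearMap.ker_eq_bot, LinearMap.ker_eq_bot']
    intro v hv
    have hv' : C.mulVec v = 0 := hv
    have h2 : (B * C).mulVec v = 0 := by
      rw [← Matrix.mulVec_mulVec, hv', Matrix.mulVec_zero]
    rw [h, Matrix.smul_mulVec, Matrix.one_mulVec] at h2
    exact (smul_eq_zero.1 h2).resolve_left hQ
  have := le_of_fin_injective R C.mulVecLin hinj
  omega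

theorem exists_notMem {K : Type} [Field K] {ℓ : ℕ}
    (A : Finset (Submodule K (Fin ℓ → K)))
    (hA : IsArrangement A) (hEss : Essential A) (hlf : LocallyFree A)
    (Θ : Fin (ℓ + 1) → Deriv K ℓ) (F : Fin (ℓ + 1) → MvPolynomial (Fin ℓ) K)
    (hmem : ∀ i, InD A (Θ i))
    (hgen : ∀ η, InD A η → ∃ c : Fin (ℓ + 1) → MvPolynomial (Fin ℓ) K, η = ∑ i, c i • Θ i)
    (hsyz : ∀ c : Fin (ℓ + 1) → MvPolynomial (Fin ℓ) K, (∑ i, c i • Θ i) = 0 →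
      ∃ q : MvPolynomial (Fin ℓ) K, ∀ i, c i = q * F i)
    (p : Ideal (MvPolynomial (Fin ℓ) K)) [hpp : p.IsPrime]
    (hpX : ∃ j, MvPolynomial.X j ∉ p) : ∃ i, F i ∉ p := by
  by_contra! hF
  choose! φ hφ0 hφk using hA
  let B := A.filter (fun H => linPoly (φ H) ∈ p)
  have hspan : ∀ ψ, B.inf id ≤ LinearMap.ker ψ → linPoly ψ ∈ p :=
    linPoly_mem_of_span p B φ (fun H hH => hφk H (Finset.mem_filter.1 hH).1)
      (fun H hH => (Finset.mem_filter.1 hH).2)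
  have hX : B.inf id ≠ A.inf id := by
    intro h
    obtain ⟨j, hj⟩ := hpX
    apply hj
    have := hspan (LinearMap.proj j) (by rw [h, hEss]; exact bot_le)
    simpa [linPoly, Pi.single_apply] using this
  obtain ⟨_, ψ, _, ⟨hψ1, hψ2⟩, _⟩ := hlf (B.inf id)
    (Finset.mem_image.2 ⟨B, Finset.mem_powerset.2 (Finset.filter_subset _ _), by simp⟩) hX
  let Q := ∏ H ∈ A.filter (fun H => linPoly (φ H) ∉ p), linPoly (φ H)
  have hQ : Q ∉ p := by
    intro h
    obtain ⟨H, hH, h2⟩ := (Ideal.IsPrime.prod_mem_iff).1 h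
    exact (Finset.mem_filter.1 hH).2 h2
  have hQψ : ∀ j, InD A (Q • ψ j) := by
    intro j H hH φ' hφ'
    rw [applyLin_smul]
    by_cases h : linPoly (φ H) ∈ p
    · refine Dvd.dvd.mul_left (hψ1 j H ?_ φ' hφ') _
      exact Finset.mem_filter.2 ⟨hH, Finset.inf_le (f := id) (Finset.mem_filter.2 ⟨hH, h⟩)⟩
    · refine Dvd.dvd.mul_right ?_ _
      refine (linPoly_dvd φ' (φ H) (by rw [hφ', hφk H hH])).trans ?_
      exact Finset.dvd_prod_of_mem (fun H => linPoly (φ H)) (Finset.mem_filter.2 ⟨hH, h⟩)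
  have hΘ : ∀ i, InD (localize A (B.inf id)) (Θ i) := fun i H hH =>
    hmem i H (Finset.mem_filter.1 hH).1
  choose b hb using fun i => hψ2 _ (hΘ i)
  choose c hc using fun j => hgen _ (hQψ j)
  have key : ∀ i k, (∑ j, b i j * c j k) - (if i = k then Q else 0) ∈ p := by
    intro i
    obtain ⟨q, hq⟩ := hsyz (fun k => (∑ j, b i j * c j k) - (if i = k then Q else 0)) (by
      simp only [sub_smul, Finset.sum_sub_distrib, ite_smul, zero_smul, Finset.sum_ite_eq,
        Finset.mem_univ, if_true, Finset.sum_smul, mul_smul]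
      rw [Finset.sum_comm]
      simp only [← Finset.smul_sum, ← hc]
      rw [hb i, Finset.smul_sum, sub_eq_zero]
      exact Finset.sum_congr rfl fun j _ => smul_comm _ _ _)
    intro k
    rw [hq k]
    exact p.mul_mem_left _ (hF k)
  apply hQ
  rw [← Ideal.Quotient.eq_zero_iff_mem]
  apply factor_zero _ (Matrix.of fun i j => Ideal.Quotient.mk p (b i j))
    (Matrix.of fun j k => Ideal.Quotient.mk p (c j k))
  ext i k
  have := (Ideal.Quotient.eq (I := p)).2 (key i k)
  simp only [map_sum, map_mul] at this
  rw [Matrix.mul_apply]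
  simp only [Matrix.of_apply, this, Matrix.smul_apply, Matrix.one_apply]
  split_ifs <;> simp

/-- Theorem `locallyfree`, the locally free trick: if `A` is locally
free but not free and `D(A)` has a minimal free resolution
`0 → S[-d-1] →^F ⊕_{i=1}^{ℓ+1} S[-dᵢ] →^G D(A) → 0` with `G = (θ_E, θ₂, …, θ_{ℓ+1})`,
then `fᵢ ≠ 0` for all `i = 2,…,ℓ+1`. -/
theorem locally_free_trick {K : Type} [Field K] {ℓ : ℕ}
    (A : Finset (Submodule K (Fin ℓ → K)))
    (hA : IsArrangement A) (hEss : Essential A)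
    (hlf : LocallyFree A) (hnf : ¬ IsFree A)
    (Θ : Fin (ℓ + 1) → Deriv K ℓ) (e : Fin (ℓ + 1) → ℕ)
    (F : Fin (ℓ + 1) → MvPolynomial (Fin ℓ) K) (d : ℕ)
    (hΘ0 : Θ 0 = eulerD)
    (hmem : ∀ i, InD A (Θ i)) (hhom : ∀ i, HomogDeriv (Θ i) (e i))
    (hgen : ∀ η, InD A η → ∃ c : Fin (ℓ + 1) → MvPolynomial (Fin ℓ) K, η = ∑ i, c i • Θ i)
    (hrel : (∑ i, F i • Θ i) = 0)
    (hFhom : ∀ i, (F i).IsHomogeneous (d + 1 - e i))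
    (hFmin : ∀ i, MvPolynomial.constantCoeff (F i) = 0)
    (hFne : ¬ ∀ i, F i = 0)
    (hsyz : ∀ c : Fin (ℓ + 1) → MvPolynomial (Fin ℓ) K, (∑ i, c i • Θ i) = 0 →
      ∃ q : MvPolynomial (Fin ℓ) K, ∀ i, c i = q * F i) :
    ∀ i : Fin (ℓ + 1), i ≠ 0 → F i ≠ 0 := by
  intro i hi hFi
  -- a hyperplane of `A`
  have hℓ : 0 < ℓ := by
    rcases Nat.eq_zero_or_pos ℓ with h | h
    · subst h; exact absurd (Fin.ext (by omega)) hi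
    · exact h
  have hne : A.Nonempty := by
    rw [Finset.nonempty_iff_ne_empty]
    rintro rfl
    have h1 : (⊤ : Submodule K (Fin ℓ → K)) = ⊥ := by simpa [Essential] using hEss
    have h2 : (Pi.single (⟨0, hℓ⟩ : Fin ℓ) (1 : K)) ∈ (⊥ : Submodule K (Fin ℓ → K)) :=
      h1 ▸ Submodule.mem_top
    simp at h2
  obtain ⟨H, hH⟩ := hne
  obtain ⟨φ, hφ0, hφk⟩ := hA H hH
  choose g hg using fun j => hmem j H hH φ hφk
  have hg0 : g 0 = 1 := by
    have h1 := hg 0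
    rw [hΘ0] at h1
    have h2 : applyLin eulerD φ = linPoly φ := rfl
    rw [h2] at h1
    exact mul_left_cancel₀ (linPoly_ne_zero φ hφ0) (by rw [mul_one]; exact h1.symm)
  have hsum : ∑ j, F j * g j = 0 := by
    have h1 := congrArg (fun θ => applyLin θ φ) hrel
    simp only [applyLin_sum, applyLin_smul, hg] at h1
    have h2 : applyLin (0 : Deriv K ℓ) φ = 0 := by simp [applyLin]
    rw [h2] at h1
    refine mul_left_cancel₀ (linPoly_ne_zero φ hφ0) ?_
    rw [mul_zero, ← h1, Finset.mul_sum]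
    exact Finset.sum_congr rfl fun j _ => by ring
  -- the ideal of the coefficients
  let T : Finset (Fin (ℓ + 1)) := (Finset.univ.erase 0).erase i
  let s : Finset (MvPolynomial (Fin ℓ) K) := T.image F
  have hTcard : T.card + 2 = ℓ + 1 := by
    have h1 : i ∈ (Finset.univ : Finset (Fin (ℓ + 1))).erase 0 := by simp [hi]
    have h2 := Finset.card_erase_add_one h1
    have h3 := Finset.card_erase_add_one (Finset.mem_univ (0 : Fin (ℓ + 1)))
    simp only [Finset.card_univ, Fintype.card_fin] at h3
    change (((Finset.univ : Finset (Fin (ℓ + 1))).erase 0).erase i).card + 2 = _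
    omega
  let m : Ideal (MvPolynomial (Fin ℓ) K) := RingHom.ker MvPolynomial.constantCoeff
  have hm : m.IsMaximal := RingHom.ker_isMaximal_of_surjective _
    (fun a => ⟨MvPolynomial.C a, by simp⟩)
  have hsm : Ideal.span (s : Set (MvPolynomial (Fin ℓ) K)) ≤ m := by
    rw [Ideal.span_le]
    intro x hx
    obtain ⟨j, _, rfl⟩ := Finset.mem_image.1 (Finset.mem_coe.1 hx)
    exact hFmin j
  obtain ⟨p, hp, hpm⟩ := Ideal.exists_minimalPrimes_le hsm
  have hpp : p.IsPrime := hp.1.1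
  have hht : p.height ≤ s.card := Ideal.height_le_card_of_mem_minimalPrimes_span_finset hp
  have hFp : ∀ j, j ≠ 0 → F j ∈ p := by
    intro j hj
    by_cases hji : j = i
    · rw [hji, hFi]; exact p.zero_mem
    · exact hp.1.2 (Ideal.subset_span (Finset.mem_coe.2
        (Finset.mem_image_of_mem F (by simp [T, hj, hji]))))
  have hF0 : F 0 ∈ p := by
    rw [Fin.sum_univ_succ, hg0, mul_one] at hsum
    rw [eq_neg_of_add_eq_zero_left hsum]
    exact p.neg_mem (p.sum_mem fun j _ => p.mul_mem_right _ (hFp _ (Fin.succ_ne_zero j)))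
  have hpX : ∃ j, MvPolynomial.X j ∉ p := by
    by_contra! hX
    have hmp : m ≤ p := by
      intro x hx
      have h1 : x ∈ Ideal.span (Set.range (MvPolynomial.X : Fin ℓ → MvPolynomial (Fin ℓ) K)) := by
        rw [← Set.image_univ, MvPolynomial.mem_ideal_span_X_image]
        intro u hu
        by_contra! h0
        have hu0 : u = 0 := Finsupp.ext fun j => h0 j (Set.mem_univ j)
        rw [MvPolynomial.mem_support_iff, hu0] at hu
        exact hu hx
      refine (Ideal.span_le.2 ?_) h1
      rintro _ ⟨j, rfl⟩
      exact hX j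
    have heq : p = m := le_antisymm hpm hmp
    have h1 := height_maximal_ge ℓ m hm
    rw [← heq] at h1
    have h2 : (ℓ : ℕ∞) ≤ s.card := h1.trans hht
    have h3 : ℓ ≤ s.card := by exact_mod_cast h2
    have h4 : s.card ≤ T.card := Finset.card_image_le
    omega
  obtain ⟨j, hj⟩ := exists_notMem A hA hEss hlf Θ F hmem hgen hsyz p hpX
  by_cases hj0 : j = 0
  · exact hj (hj0 ▸ hF0)
  · exact hj (hFp j hj0)

end ArrPOG
end
end

section
/- Let ℓ = 3. Then every plus-one generated arrangement in K^3 is strictly plus-one generated. -/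
open MvPolynomial

noncomputable section

attribute [local instance] Classical.propDecidable

namespace ArrPOG

variable (K : Type) [Field K] (ℓ : ℕ)

variable {K ℓ}

section Aux

variable {K : Type} [Field K]

theorem aux_applyLin_add (θ η : Deriv K 3) (a : Module.Dual K (Fin 3 → K)) :
    applyLin (θ + η) a = applyLin θ a + applyLin η a := by
  simp [applyLin, mul_add, Finset.sum_add_distrib]

theorem aux_applyLin_smul (p : MvPolynomial (Fin 3) K) (η : Deriv K 3)
    (a : Module.Dual K (Fin 3 → K)) :
    applyLin (p • η) a = p * applyLin η a := by
  simp only [applyLin, Finset.mul_sum, Pi.smul_apply, smul_eq_mul]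
  exact Finset.sum_congr rfl fun i _ => by ring

theorem aux_applyLin_zero (a : Module.Dual K (Fin 3 → K)) :
    applyLin (0 : Deriv K 3) a = 0 := by
  simp [applyLin]

theorem aux_exists_ne {a : Module.Dual K (Fin 3 → K)} (ha : a ≠ 0) :
    ∃ k, a (Pi.single k 1) ≠ 0 := by
  by_contra h
  push Not at h
  apply ha
  apply LinearMap.pi_ext'
  intro i
  ext
  simpa using h i

theorem aux_coeff (h : MvPolynomial (Fin 3) K) (a : Module.Dual K (Fin 3 → K)) (k : Fin 3) :
    coeff (Finsupp.single k 1) (h * linPoly a) = constantCoeff h * a (Pi.single k 1) := by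
  have h1 : ∀ i : Fin 3, coeff (Finsupp.single k 1) (h * (C (a (Pi.single i 1)) * X i)) =
      if i = k then constantCoeff h * a (Pi.single k 1) else 0 := by
    intro i
    rw [← mul_assoc, coeff_mul_X']
    by_cases hik : i = k
    · subst hik
      rw [mul_comm h, if_pos (by simp), if_pos rfl, coeff_C_mul, tsub_self, constantCoeff_eq,
        mul_comm]
    · have : ¬ (k = i) := fun h => hik h.symm
      simp [hik, this, Finsupp.single_apply]
  rw [linPoly, Finset.mul_sum, coeff_sum, Finset.sum_congr rfl (fun i _ => h1 i)]
  simp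

theorem aux_lin_homog (a : Module.Dual K (Fin 3 → K)) : (linPoly a).IsHomogeneous 1 :=
  IsHomogeneous.sum _ _ _ fun i _ => isHomogeneous_C_mul_X _ _

theorem aux_lin_ne {a : Module.Dual K (Fin 3 → K)} (ha : a ≠ 0) : linPoly a ≠ 0 := by
  obtain ⟨k, hk⟩ := aux_exists_ne ha
  intro h
  have := aux_coeff 1 a k
  rw [h] at this
  simp at this
  exact hk this.symm

theorem aux_lin_prime {a : Module.Dual K (Fin 3 → K)} (ha : a ≠ 0) : Prime (linPoly a) := by
  rw [← UniqueFactorizationMonoid.irreducible_iff_prime]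
  apply irreducible_of_totalDegree_eq_one ((aux_lin_homog a).totalDegree (aux_lin_ne ha))
  intro x hx
  rw [isUnit_iff_ne_zero]
  rintro rfl
  apply aux_lin_ne ha
  ext d
  simpa using hx d

theorem aux_ker_ne {A : Finset (Submodule K (Fin 3 → K))} (hA : IsArrangement A)
    {H : Submodule K (Fin 3 → K)} (hH : H ∈ A) {a : Module.Dual K (Fin 3 → K)}
    (ha : LinearMap.ker a = H) : a ≠ 0 := by
  obtain ⟨b, hb, hbH⟩ := hA H hH
  rintro rfl
  apply hb
  rw [← LinearMap.ker_eq_top, hbH, ← ha, LinearMap.ker_zero]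

theorem aux_ess {A : Finset (Submodule K (Fin 3 → K))} (hA : IsArrangement A)
    (hE : Essential A) (η : Deriv K 3)
    (h : ∀ H ∈ A, ∀ a : Module.Dual K (Fin 3 → K), LinearMap.ker a = H → applyLin η a = 0) :
    η = 0 := by
  have key : ∀ d, (fun k => coeff d (η k)) = (0 : Fin 3 → K) := by
    intro d
    have : (fun k => coeff d (η k)) ∈ A.inf id := by
      rw [Submodule.mem_finsetInf]
      intro H hH
      obtain ⟨a, -, haH⟩ := hA H hH
      have h0 := congrArg (coeff d) (h H hH a haH)
      simp only [id, ← haH, LinearMap.mem_ker]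
      rw [LinearMap.pi_apply_eq_sum_univ a]
      simp only [applyLin, coeff_sum, coeff_C_mul, coeff_zero] at h0
      refine Eq.trans ?_ h0
      refine Finset.sum_congr rfl fun i _ => ?_
      rw [smul_eq_mul, mul_comm]
      congr 2
      ext j
      simp [Pi.single_apply, eq_comm]
    rw [hE] at this
    simpa using this
  funext k
  ext d
  simpa using congrFun (key d) k

theorem aux_core {A : Finset (Submodule K (Fin 3 → K))} (hA : IsArrangement A)
    {H : Submodule K (Fin 3 → K)} (hH : H ∈ A) {a : Module.Dual K (Fin 3 → K)}
    (ha : LinearMap.ker a = H)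
    (t1 t2 t3 φ : Deriv K 3) (f1 f2 f3 h1 h2 h3 : MvPolynomial (Fin 3) K)
    (d1 : InD A t1) (d2 : InD A t2) (d3 : InD A t3)
    (gen : ∀ η, InD A η → ∃ c1 c2 c3 g : MvPolynomial (Fin 3) K,
      η = c1 • t1 + c2 • t2 + c3 • t3 + g • φ)
    (k2 : constantCoeff f2 = 0) (k3 : constantCoeff f3 = 0)
    (rel : f1 • t1 + f2 • t2 + f3 • t3 = 0)
    (nz : ¬ (f1 = 0 ∧ f2 = 0 ∧ f3 = 0))
    (syz : ∀ g1 g2 g3 h : MvPolynomial (Fin 3) K, g1 • t1 + g2 • t2 + g3 • t3 + h • φ = 0 →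
      ∃ q, g1 = q * f1 ∧ g2 = q * f2 ∧ g3 = q * f3)
    (e1 : applyLin t1 a = linPoly a * h1) (e2 : applyLin t2 a = linPoly a * h2)
    (e3 : applyLin t3 a = linPoly a * h3) (hc : constantCoeff h1 ≠ 0) : False := by
  have hrel : f1 * h1 + f2 * h2 + f3 * h3 = 0 := by
    have := congrArg (fun θ => applyLin θ a) rel
    simp only [aux_applyLin_add, aux_applyLin_smul, aux_applyLin_zero, e1, e2, e3] at this
    apply mul_left_cancel₀ (aux_lin_ne (aux_ker_ne hA hH ha))
    linear_combination this
  have h1ne : h1 ≠ 0 := by rintro rfl; simp at hc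
  have hne : ¬ (f2 = 0 ∧ f3 = 0) := by
    rintro ⟨rfl, rfl⟩
    apply nz
    simpa [h1ne] using hrel
  obtain ⟨u, v, g, huv, hu, hv⟩ : ∃ u v g, IsRelPrime u v ∧ g * u = f2 ∧ g * v = f3 := by
    by_cases h : f2 = 0
    · have h3 : f3 ≠ 0 := fun h' => hne ⟨h, h'⟩
      exact UniqueFactorizationMonoid.exists_reduced_factors' f2 f3 h3
    · exact UniqueFactorizationMonoid.exists_reduced_factors f2 h f3
  have hg : g ≠ 0 := by
    rintro rfl
    exact hne ⟨by simpa using hu.symm, by simpa using hv.symm⟩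
  have relk : ∀ k, f1 * t1 k + f2 * t2 k + f3 * t3 k = 0 := fun k => by
    simpa using congrFun rel k
  have relu : ∀ k, u * (h1 * t2 k - h2 * t1 k) + v * (h1 * t3 k - h3 * t1 k) = 0 := by
    intro k
    apply mul_left_cancel₀ hg
    have := relk k
    rw [← hu, ← hv] at this hrel
    linear_combination h1 * this - t1 k * hrel
  -- g divides h1
  obtain ⟨q, -, q2, q3⟩ := syz (-(u * h2 + v * h3)) (u * h1) (v * h1) 0 (by
    funext k
    simp only [Pi.add_apply, Pi.smul_apply, smul_eq_mul, Pi.zero_apply]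
    linear_combination relu k)
  have hqg : h1 = q * g := by
    by_cases hu0 : u = 0
    · have hv0 : v ≠ 0 := by
        rintro rfl
        exact hne ⟨by rw [← hu, hu0, mul_zero], by rw [← hv, mul_zero]⟩
      apply mul_left_cancel₀ hv0
      rw [q3, ← hv]; ring
    · apply mul_left_cancel₀ hu0
      rw [q2, ← hu]; ring
  have hgc : constantCoeff g ≠ 0 := by
    intro h
    apply hc
    rw [hqg, map_mul, h, mul_zero]
  have huc : constantCoeff u = 0 := by
    rw [← hu, map_mul] at k2
    exact (mul_eq_zero.1 k2).resolve_left hgc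
  have hvc : constantCoeff v = 0 := by
    rw [← hv, map_mul] at k3
    exact (mul_eq_zero.1 k3).resolve_left hgc
  have hu0 : u ≠ 0 := by
    rintro rfl
    rw [isRelPrime_zero_left] at huv
    have := huv.map (constantCoeff (σ := Fin 3) (R := K))
    rw [hvc] at this
    simp at this
  have hdvd : ∀ k, u ∣ h1 * t3 k - h3 * t1 k := by
    intro k
    apply huv.dvd_of_dvd_mul_left
    exact ⟨-(h1 * t2 k - h2 * t1 k), by linear_combination relu k⟩
  choose η hη using hdvd
  have hη2 : ∀ k, h1 * t2 k - h2 * t1 k = - v * η k := by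
    intro k
    apply mul_left_cancel₀ hu0
    linear_combination relu k - v * hη k
  have v3 : h1 • t3 + (-h3) • t1 = u • (η : Deriv K 3) := by
    funext k
    simp only [Pi.add_apply, Pi.smul_apply, smul_eq_mul]
    linear_combination hη k
  have v2 : h1 • t2 + (-h2) • t1 = (-v) • (η : Deriv K 3) := by
    funext k
    simp only [Pi.add_apply, Pi.smul_apply, smul_eq_mul]
    linear_combination hη2 k
  have dη : InD A η := by
    intro L hL b hb
    have pb := aux_lin_prime (aux_ker_ne hA hL hb)
    have w3 := congrArg (fun θ => applyLin θ b) v3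
    have w2 := congrArg (fun θ => applyLin θ b) v2
    simp only [aux_applyLin_add, aux_applyLin_smul] at w3 w2
    have x3 : linPoly b ∣ u * applyLin η b := by
      rw [← w3]
      exact dvd_add ((d3 L hL b hb).mul_left _) ((d1 L hL b hb).mul_left _)
    have x2 : linPoly b ∣ (-v) * applyLin η b := by
      rw [← w2]
      exact dvd_add ((d2 L hL b hb).mul_left _) ((d1 L hL b hb).mul_left _)
    rcases pb.dvd_or_dvd x3 with y3 | y3
    · rcases pb.dvd_or_dvd x2 with y2 | y2
      · exact absurd (huv y3 ((dvd_neg).1 y2)) pb.not_isUnit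
      · exact y2
    · exact y3
  obtain ⟨c1, c2, c3, c, hc'⟩ := gen η dη
  obtain ⟨q', -, -, q3'⟩ := syz (-h3 - u * c1) (- u * c2) (h1 - u * c3) (-u * c) (by
    funext k
    have := congrFun hc' k
    simp only [Pi.add_apply, Pi.smul_apply, smul_eq_mul, Pi.zero_apply] at this ⊢
    linear_combination hη k + u * this)
  have := congrArg constantCoeff q3'
  simp [huc, k3] at this
  exact hc this

theorem aux_level_one {A : Finset (Submodule K (Fin 3 → K))} (hA : IsArrangement A)
    (hE : Essential A) (θ : Fin 3 → Deriv K 3) (f : Fin 3 → MvPolynomial (Fin 3) K)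
    (e : Fin 3 → ℕ) (dθ : ∀ i, InD A (θ i)) (hom : ∀ i, HomogDeriv (θ i) (e i))
    (he : ∀ i, f i ≠ 0 → e i ≤ 1)
    (kf : ∀ i, constantCoeff (f i) = 0)
    (rel : ∑ i, f i • θ i = 0)
    (syz : ∀ g : Fin 3 → MvPolynomial (Fin 3) K, ∑ i, g i • θ i = 0 →
      ∃ q, ∀ i, g i = q * f i) : ∀ i, f i = 0 := by
  have diag : ∀ H ∈ A, ∀ a : Module.Dual K (Fin 3 → K), LinearMap.ker a = H →
      ∀ i, f i ≠ 0 → ∃ m : K, applyLin (θ i) a = linPoly a * C m := by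
    intro H hH a ha i hi
    obtain ⟨h, hh⟩ := dθ i H hH a ha
    have ane := aux_ker_ne hA hH ha
    by_cases h0 : h = 0
    · exact ⟨0, by rw [hh, h0]; simp⟩
    have hhom : (applyLin (θ i) a).IsHomogeneous (e i) :=
      IsHomogeneous.sum _ _ _ fun k _ => (hom i k).C_mul _
    have hd := hhom.totalDegree_le
    rw [hh, totalDegree_mul_of_isDomain (aux_lin_ne ane) h0,
      (aux_lin_homog a).totalDegree (aux_lin_ne ane)] at hd
    have h1 := he i hi
    have : h.totalDegree = 0 := by omega
    rw [totalDegree_eq_zero_iff_eq_C] at this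
    exact ⟨_, by rw [hh, ← this]⟩
  have key : ∀ d, ∑ i, (C (coeff d (f i)) : MvPolynomial (Fin 3) K) • θ i = 0 := by
    intro d
    apply aux_ess hA hE
    intro H hH a ha
    have hm : ∀ i, ∃ m : K, f i ≠ 0 → applyLin (θ i) a = linPoly a * C m := by
      intro i
      by_cases hi : f i = 0
      · exact ⟨0, fun h => absurd hi h⟩
      · obtain ⟨m, hm⟩ := diag H hH a ha i hi
        exact ⟨m, fun _ => hm⟩
    choose m hm using hm
    have r1 := congrArg (fun θ => applyLin θ a) rel
    simp only [Fin.sum_univ_three, aux_applyLin_add, aux_applyLin_smul, aux_applyLin_zero] at r1 ⊢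
    have r2 : ∀ i, f i * applyLin (θ i) a = linPoly a * (C (m i) * f i) := by
      intro i
      by_cases hi : f i = 0
      · simp [hi]
      · rw [hm i hi]; ring
    have r3 : ∀ i, (C (coeff d (f i)) : MvPolynomial (Fin 3) K) * applyLin (θ i) a
        = linPoly a * C (coeff d (C (m i) * f i)) := by
      intro i
      by_cases hi : f i = 0
      · simp [hi]
      · rw [hm i hi, coeff_C_mul, C_mul]; ring
    rw [r2, r2, r2, ← mul_add, ← mul_add] at r1
    have r4 := (mul_eq_zero.1 r1).resolve_left (aux_lin_ne (aux_ker_ne hA hH ha))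
    rw [r3, r3, r3, ← mul_add, ← mul_add, ← C_add, ← C_add, ← coeff_add, ← coeff_add, r4]
    simp
  intro i
  ext d
  obtain ⟨q, hq⟩ := syz _ (key d)
  have := congrArg constantCoeff (hq i)
  simpa [kf i] using this

end Aux

/-- Proposition `s`: for `ℓ = 3`, every plus-one generated
arrangement is strictly plus-one generated (with the same exponents and level). -/
theorem POG_is_SPOG_dim3 {K : Type} [Field K]
    (A : Finset (Submodule K (Fin 3 → K)))
    (hA : IsArrangement A) (hEss : Essential A)
    (e : Fin 3 → ℕ) (lev : ℕ) (hpog : IsPOG A e lev) :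
    IsSPOG A e lev := by
  obtain ⟨θ, φ, f, α, hp⟩ := hpog
  refine ⟨θ, φ, f, α, hp, ?_⟩
  rintro rfl
  obtain ⟨dθ, dφ, hom, homφ, gen, -, homf, kf, rel, nz, syz⟩ := hp
  simp only [zero_smul, add_zero] at rel
  have nz' : ¬ ∀ i, f i = 0 := fun h => nz ⟨rfl, h⟩
  -- choose a hyperplane
  have hne : A.Nonempty := by
    rw [Finset.nonempty_iff_ne_empty]
    rintro rfl
    simp only [Essential, Finset.inf_empty] at hEss
    exact top_ne_bot hEss
  obtain ⟨H, hH⟩ := hne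
  obtain ⟨a, ane, ha⟩ := hA H hH
  have hex := fun i => dθ i H hH a ha
  choose h hh using hex
  obtain ⟨hφ, hhφ⟩ := dφ H hH a ha
  have dE : InD A (eulerD : Deriv K 3) := fun L _ b _ => dvd_refl _
  obtain ⟨c, g, hcg⟩ := gen _ dE
  have hone : (1 : MvPolynomial (Fin 3) K) = c 0 * h 0 + c 1 * h 1 + c 2 * h 2 + g * hφ := by
    have := congrArg (fun θ => applyLin θ a) hcg
    simp only [Fin.sum_univ_three, aux_applyLin_add, aux_applyLin_smul, hh, hhφ] at this
    have hE : applyLin (eulerD : Deriv K 3) a = linPoly a := rfl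
    rw [hE] at this
    apply mul_left_cancel₀ (aux_lin_ne ane)
    linear_combination this
  rw [Fin.sum_univ_three] at rel
  have noθ : ∀ i, constantCoeff (h i) = 0 := by
    have gen' : ∀ η, InD A η → ∃ c0 c1 c2 g : MvPolynomial (Fin 3) K,
        η = c0 • θ 0 + c1 • θ 1 + c2 • θ 2 + g • φ := by
      intro η hη
      obtain ⟨c, g, h⟩ := gen η hη
      exact ⟨c 0, c 1, c 2, g, by rw [h, Fin.sum_univ_three]⟩
    have syz' : ∀ g0 g1 g2 h : MvPolynomial (Fin 3) K,
        g0 • θ 0 + g1 • θ 1 + g2 • θ 2 + h • φ = 0 →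
        ∃ q, g0 = q * f 0 ∧ g1 = q * f 1 ∧ g2 = q * f 2 := by
      intro g0 g1 g2 h hr
      obtain ⟨q, hq, -⟩ := syz ![g0, g1, g2] h (by simpa [Fin.sum_univ_three] using hr)
      exact ⟨q, hq 0, hq 1, hq 2⟩
    have nz3 : ¬ (f 0 = 0 ∧ f 1 = 0 ∧ f 2 = 0) := by
      rintro ⟨x, y, z⟩
      apply nz'
      intro i
      fin_cases i <;> assumption
    intro i
    by_contra hi
    fin_cases i
    · exact aux_core hA hH ha (θ 0) (θ 1) (θ 2) φ (f 0) (f 1) (f 2) (h 0) (h 1) (h 2)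
        (dθ _) (dθ _) (dθ _) gen' (kf _) (kf _) rel nz3 syz' (hh _) (hh _) (hh _) hi
    · refine aux_core hA hH ha (θ 1) (θ 0) (θ 2) φ (f 1) (f 0) (f 2) (h 1) (h 0) (h 2)
        (dθ _) (dθ _) (dθ _) ?_ (kf _) (kf _) ?_ (by tauto) ?_ (hh _) (hh _) (hh _) hi
      · intro η hη
        obtain ⟨c0, c1, c2, g, hc⟩ := gen' η hη
        exact ⟨c1, c0, c2, g, by rw [hc]; abel⟩
      · rw [← rel]; abel
      · intro g1 g0 g2 h hr
        obtain ⟨q, x, y, z⟩ := syz' g0 g1 g2 h (by rw [← hr]; abel)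
        exact ⟨q, y, x, z⟩
    · refine aux_core hA hH ha (θ 2) (θ 0) (θ 1) φ (f 2) (f 0) (f 1) (h 2) (h 0) (h 1)
        (dθ _) (dθ _) (dθ _) ?_ (kf _) (kf _) ?_ (by tauto) ?_ (hh _) (hh _) (hh _) hi
      · intro η hη
        obtain ⟨c0, c1, c2, g, hc⟩ := gen' η hη
        exact ⟨c2, c0, c1, g, by rw [hc]; abel⟩
      · rw [← rel]; abel
      · intro g2 g0 g1 h hr
        obtain ⟨q, x, y, z⟩ := syz' g0 g1 g2 h (by rw [← hr]; abel)
        exact ⟨q, z, x, y⟩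
  have hφc : constantCoeff hφ ≠ 0 := by
    intro h0
    have := congrArg constantCoeff hone
    simp [noθ, h0] at this
  -- hence the level is one
  have hlev : lev = 1 := by
    obtain ⟨k, hk⟩ := aux_exists_ne ane
    have hhom : (applyLin φ a).IsHomogeneous lev :=
      IsHomogeneous.sum _ _ _ fun k _ => (homφ k).C_mul _
    by_contra hl
    have := hhom.coeff_eq_zero (d := Finsupp.single k 1) (by simpa using fun h => hl h.symm)
    rw [hhφ, mul_comm, aux_coeff] at this
    exact mul_ne_zero hφc hk this
  apply nz'
  refine aux_level_one hA hEss θ f e dθ hom ?_ kf (by rw [Fin.sum_univ_three]; exact rel) ?_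
  · intro i hi
    by_contra hlt
    apply hi
    have := homf i
    have h0 : lev + 1 - e i = 0 := by omega
    rw [h0, ← totalDegree_zero_iff_isHomogeneous, totalDegree_eq_zero_iff_eq_C,
      ← constantCoeff_eq, kf i, C_0] at this
    exact this
  · intro g hg
    obtain ⟨q, hq, -⟩ := syz g 0 (by simpa using hg)
    exact ⟨q, hq⟩

end ArrPOG
end
end
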